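/- Fix an integer d ≥ 1, s ∈ (0,1) and t_0 > 0. There exist ε_0 > 0 and C > 0, depending only on d, s and t_0, such that for every bounded measurable function g : ℝ^d → ℂ, every ε ∈ (0, ε_0], and every t ≥ t_0: ∫_{ℝ^d} ∫_{ℝ^d} |g(ξ)|² · | e^{−J(ε,t,k,ξ)} − e^{−(|ξ|^{2s} t + |k|^{2s}/(2s))} |² dk dξ ≤ C ε^{2s} (sup_{ξ} |g(ξ)|)². -/

import Mathlib

open MeasureTheory

/-- `J(ε,t,k,ξ) = ∫_0^{ε^{−2s} t} |e^{−w}(k − εξ) + εξ|^{2s} dw`, with real powers. -/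
noncomputable def Jfun (d : ℕ) (s ε t : ℝ) (k ξ : EuclideanSpace ℝ (Fin d)) : ℝ :=
  ∫ w in (0 : ℝ)..(ε ^ (-(2 * s)) * t), ‖Real.exp (-w) • (k - ε • ξ) + ε • ξ‖ ^ (2 * s)

lemma Real.two_mul_rpow_eq_sq {x : ℝ} (hx : 0 ≤ x) (s : ℝ) : x ^ (2 * s) = (x ^ s) ^ 2 := by
  rw [← Real.rpow_natCast, ← Real.rpow_mul hx, mul_comm]; norm_num

lemma norm_add_rpow_le {E : Type*} [SeminormedAddCommGroup E] {s : ℝ} (hs₀ : 0 ≤ s) (hs₁ : s ≤ 1)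
    (a b : E) : ‖a + b‖ ^ s ≤ ‖a‖ ^ s + ‖b‖ ^ s :=
  (Real.rpow_le_rpow (norm_nonneg _) (norm_add_le a b) hs₀).trans
    (Real.rpow_add_le_add_rpow (norm_nonneg _) (norm_nonneg _) hs₀ hs₁)

/-- For `0 ≤ s ≤ 1` the function `x ↦ ‖x‖ ^ (2 * s)` is additive up to a cross term. -/
lemma abs_norm_add_rpow_sub_le {E : Type*} [SeminormedAddCommGroup E] {s : ℝ} (hs₀ : 0 ≤ s)
    (hs₁ : s ≤ 1) (a b : E) :
    |‖a + b‖ ^ (2 * s) - ‖a‖ ^ (2 * s) - ‖b‖ ^ (2 * s)| ≤ 2 * ‖a‖ ^ s * ‖b‖ ^ s := by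
  have h₁ := norm_add_rpow_le hs₀ hs₁ a b
  have h₂ := norm_add_rpow_le hs₀ hs₁ (a + b) (-b)
  have h₃ := norm_add_rpow_le hs₀ hs₁ (a + b) (-a)
  rw [add_neg_cancel_right, norm_neg] at h₂
  rw [add_neg_cancel_comm, norm_neg] at h₃
  simp only [Real.two_mul_rpow_eq_sq (norm_nonneg _)]
  have ha : 0 ≤ ‖a‖ ^ s := by positivity
  have hb : 0 ≤ ‖b‖ ^ s := by positivity
  have hn : 0 ≤ ‖a + b‖ ^ s := by positivity
  have h₄ : (‖a‖ ^ s - ‖b‖ ^ s) ^ 2 ≤ (‖a + b‖ ^ s) ^ 2 :=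
    sq_le_sq' (by linarith) (by linarith)
  have h₅ : (‖a + b‖ ^ s) ^ 2 ≤ (‖a‖ ^ s + ‖b‖ ^ s) ^ 2 := by gcongr
  rw [abs_le]
  constructor <;> nlinarith

lemma integral_exp_neg_mul {c : ℝ} (hc : c ≠ 0) (T : ℝ) :
    ∫ w in (0 : ℝ)..T, Real.exp (-(c * w)) = (1 - Real.exp (-(c * T))) / c := by
  have h : ∀ w ∈ Set.uIcc 0 T,
      HasDerivAt (fun w => -Real.exp (-(c * w)) / c) (Real.exp (-(c * w))) w := by
    intro w _
    have h₁ : HasDerivAt (fun w : ℝ => -(c * w)) (-(c * 1)) w :=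
      ((hasDerivAt_id w).const_mul c).neg
    exact (h₁.exp.neg.div_const c).congr_deriv (by field_simp)
  rw [intervalIntegral.integral_eq_sub_of_hasDerivAt h
    (Continuous.intervalIntegrable (by fun_prop) _ _)]
  simp only [mul_zero, neg_zero, Real.exp_zero]
  ring

/-- The integral of `‖e^{-w} p + v‖ ^ (2 * s)` splits up to a cross term. -/
lemma abs_integral_norm_exp_smul_add_sub_le {E : Type*} [NormedAddCommGroup E] [NormedSpace ℝ E]
    {s : ℝ} (hs₀ : 0 < s) (hs₁ : s ≤ 1) {T : ℝ} (hT : 0 ≤ T) (p v : E) :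
    |(∫ w in (0 : ℝ)..T, ‖Real.exp (-w) • p + v‖ ^ (2 * s)) -
        (1 - Real.exp (-(2 * s * T))) / (2 * s) * ‖p‖ ^ (2 * s) - T * ‖v‖ ^ (2 * s)| ≤
      2 / s * ‖p‖ ^ s * ‖v‖ ^ s := by
  have hexp : ∀ r w : ℝ, Real.exp (-w) ^ r = Real.exp (-(r * w)) := fun r w => by
    rw [← Real.exp_mul]; ring_nf
  have hnorm : ∀ r w : ℝ, ‖Real.exp (-w) • p‖ ^ r = Real.exp (-(r * w)) * ‖p‖ ^ r := fun r w => by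
    rw [norm_smul, Real.norm_of_nonneg (Real.exp_pos _).le,
      Real.mul_rpow (Real.exp_pos _).le (norm_nonneg _), hexp]
  have hc : Continuous fun w : ℝ => ‖Real.exp (-w) • p + v‖ ^ (2 * s) :=
    Continuous.rpow_const (by fun_prop) fun _ => Or.inr (by positivity)
  have hsplit : (∫ w in (0 : ℝ)..T, ‖Real.exp (-w) • p + v‖ ^ (2 * s)) -
        (1 - Real.exp (-(2 * s * T))) / (2 * s) * ‖p‖ ^ (2 * s) - T * ‖v‖ ^ (2 * s) =
      ∫ w in (0 : ℝ)..T, (‖Real.exp (-w) • p + v‖ ^ (2 * s) -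
        Real.exp (-(2 * s * w)) * ‖p‖ ^ (2 * s) - ‖v‖ ^ (2 * s)) := by
    have he : Continuous fun w : ℝ => Real.exp (-(2 * s * w)) * ‖p‖ ^ (2 * s) := by fun_prop
    rw [intervalIntegral.integral_sub (f := fun w => _ - _)
        ((hc.sub he).intervalIntegrable _ _) (continuous_const.intervalIntegrable _ _),
      intervalIntegral.integral_sub (hc.intervalIntegrable _ _) (he.intervalIntegrable _ _),
      intervalIntegral.integral_mul_const, integral_exp_neg_mul (by positivity)]
    simp
  rw [hsplit]
  calc |∫ w in (0 : ℝ)..T, (‖Real.exp (-w) • p + v‖ ^ (2 * s) -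
        Real.exp (-(2 * s * w)) * ‖p‖ ^ (2 * s) - ‖v‖ ^ (2 * s))|
      ≤ ∫ w in (0 : ℝ)..T, Real.exp (-(s * w)) * (2 * ‖p‖ ^ s * ‖v‖ ^ s) := by
        have he : Continuous fun w : ℝ => Real.exp (-(s * w)) * (2 * ‖p‖ ^ s * ‖v‖ ^ s) := by
          fun_prop
        rw [← Real.norm_eq_abs]
        refine intervalIntegral.norm_integral_le_of_norm_le hT (ae_of_all _ fun w _ => ?_)
          (he.intervalIntegrable _ _)
        have h := abs_norm_add_rpow_sub_le hs₀.le hs₁ (Real.exp (-w) • p) v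
        rw [hnorm, hnorm] at h
        rw [Real.norm_eq_abs]
        linarith
    _ = (1 - Real.exp (-(s * T))) / s * (2 * ‖p‖ ^ s * ‖v‖ ^ s) := by
        rw [intervalIntegral.integral_mul_const, integral_exp_neg_mul hs₀.ne']
    _ ≤ 1 / s * (2 * ‖p‖ ^ s * ‖v‖ ^ s) := by
        have := Real.exp_pos (-(s * T))
        gcongr
        linarith
    _ = 2 / s * ‖p‖ ^ s * ‖v‖ ^ s := by ring

lemma abs_Jfun_sub_le (d : ℕ) {s t₀ ε t : ℝ} (hs₀ : 0 < s) (hs₁ : s ≤ 1) (ht₀ : 0 < t₀)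
    (hε₀ : 0 < ε) (hε₁ : ε ≤ 1) (ht : t₀ ≤ t) (k ξ : EuclideanSpace ℝ (Fin d)) :
    |Jfun d s ε t k ξ - (‖ξ‖ ^ (2 * s) * t + ‖k‖ ^ (2 * s) / (2 * s))| ≤
      (5 / s + 1 / (2 * s ^ 2 * t₀)) * ε ^ s * (‖k‖ ^ (2 * s) + ‖ξ‖ ^ (2 * s)) := by
  set T := ε ^ (-(2 * s)) * t with hT
  have htpos : 0 < t := ht₀.trans_le ht
  have hTpos : 0 < T := by positivity
  have hJ := abs_integral_norm_exp_smul_add_sub_le hs₀ hs₁ hTpos.le (k - ε • ξ) (ε • ξ)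
  have hP := norm_add_rpow_le hs₀.le hs₁ k (-(ε • ξ))
  have hP2 := abs_norm_add_rpow_sub_le hs₀.le hs₁ k (-(ε • ξ))
  have hv : ‖ε • ξ‖ ^ s = ε ^ s * ‖ξ‖ ^ s := by
    rw [norm_smul, Real.norm_of_nonneg hε₀.le, Real.mul_rpow hε₀.le (norm_nonneg _)]
  have he₀ : 0 < ε ^ s := by positivity
  have he₁ : ε ^ s ≤ 1 := Real.rpow_le_one hε₀.le hε₁ hs₀.le
  have hTe : T = t / (ε ^ s) ^ 2 := by
    rw [hT, Real.rpow_neg hε₀.le, Real.two_mul_rpow_eq_sq hε₀.le]; field_simp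
  have hη : Real.exp (-(2 * s * T)) ≤ (ε ^ s) ^ 2 / (2 * s * t₀) := by
    have h₁ : 2 * s * T ≤ Real.exp (2 * s * T) := by
      linarith [Real.add_one_le_exp (2 * s * T)]
    calc Real.exp (-(2 * s * T)) ≤ (2 * s * T)⁻¹ := by
          rw [Real.exp_neg]; gcongr
      _ = (ε ^ s) ^ 2 / (2 * s * t) := by rw [hTe]; field_simp
      _ ≤ _ := by gcongr
  rw [← sub_eq_add_neg, norm_neg] at hP hP2
  rw [Jfun, ← hT]
  set I := ∫ w in (0 : ℝ)..T, ‖Real.exp (-w) • (k - ε • ξ) + ε • ξ‖ ^ (2 * s)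
  simp only [Real.two_mul_rpow_eq_sq (norm_nonneg _), hv] at hJ hP hP2 ⊢
  set P := ‖k - ε • ξ‖ ^ s
  have hP₀ : 0 ≤ P := by positivity
  have hX₀ : 0 ≤ ‖k‖ ^ s := by positivity
  have hY₀ : 0 ≤ ‖ξ‖ ^ s := by positivity
  have hη₀ := Real.exp_pos (-(2 * s * T))
  set X := ‖k‖ ^ s
  set Y := ‖ξ‖ ^ s
  set e := ε ^ s
  set η := Real.exp (-(2 * s * T))
  have hTV : T * (e * Y) ^ 2 = Y ^ 2 * t := by rw [hTe]; field_simp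
  rw [hTV] at hJ
  have heY : e * Y ≤ Y := mul_le_of_le_one_left hY₀ he₁
  have hXY : 2 * X * Y ≤ X ^ 2 + Y ^ 2 := two_mul_le_add_sq X Y
  have hPV : P * (e * Y) ≤ e * (2 * (X ^ 2 + Y ^ 2)) := by
    have : P * Y ≤ (X + Y) * Y := by gcongr; linarith
    calc P * (e * Y) = e * (P * Y) := by ring
      _ ≤ _ := mul_le_mul_of_nonneg_left (by nlinarith) he₀.le
  have hPX : |P ^ 2 - X ^ 2| ≤ e * (2 * (X ^ 2 + Y ^ 2)) := by
    have h₁ : |P ^ 2 - X ^ 2| ≤ 2 * X * (e * Y) + (e * Y) ^ 2 := by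
      have := abs_le.1 hP2
      have := sq_nonneg (e * Y)
      rw [abs_le]; constructor <;> nlinarith
    calc _ ≤ _ := h₁
      _ = e * (2 * X * Y + (e * Y) * Y) := by ring
      _ ≤ e * (2 * X * Y + Y * Y) := by gcongr
      _ ≤ _ := by gcongr; nlinarith
  have hPP : P ^ 2 ≤ 2 * (X ^ 2 + Y ^ 2) := by
    have : P ^ 2 ≤ (X + Y) ^ 2 := by gcongr; linarith
    nlinarith
  have hηP : η * P ^ 2 ≤ e * (X ^ 2 + Y ^ 2) / (s * t₀) := by
    calc η * P ^ 2 ≤ e ^ 2 / (2 * s * t₀) * (2 * (X ^ 2 + Y ^ 2)) := by gcongr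
      _ = e * e * (X ^ 2 + Y ^ 2) / (s * t₀) := by field_simp
      _ ≤ e * 1 * (X ^ 2 + Y ^ 2) / (s * t₀) := by gcongr
      _ = _ := by ring
  have hdecomp : I - (Y ^ 2 * t + X ^ 2 / (2 * s)) =
      (I - (1 - η) / (2 * s) * P ^ 2 - Y ^ 2 * t) + (P ^ 2 - X ^ 2) / (2 * s)
        - η * P ^ 2 / (2 * s) := by ring
  rw [hdecomp]
  calc _ ≤ |I - (1 - η) / (2 * s) * P ^ 2 - Y ^ 2 * t| + |(P ^ 2 - X ^ 2) / (2 * s)|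
        + |η * P ^ 2 / (2 * s)| :=
        (abs_sub _ _).trans (by gcongr; exact abs_add_le _ _)
    _ = |I - (1 - η) / (2 * s) * P ^ 2 - Y ^ 2 * t| + |P ^ 2 - X ^ 2| / (2 * s)
        + η * P ^ 2 / (2 * s) := by
        rw [abs_div, abs_of_pos (by positivity : (0 : ℝ) < 2 * s),
          abs_of_nonneg (by positivity : 0 ≤ η * P ^ 2 / (2 * s))]
    _ ≤ 2 / s * (e * (2 * (X ^ 2 + Y ^ 2))) + e * (2 * (X ^ 2 + Y ^ 2)) / (2 * s)
        + e * (X ^ 2 + Y ^ 2) / (s * t₀) / (2 * s) := by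
        gcongr
        refine hJ.trans ?_
        rw [mul_assoc]
        gcongr
    _ = _ := by field_simp; ring

lemma abs_exp_neg_sub_exp_neg_le {m a b : ℝ} (ha : m ≤ a) (hb : m ≤ b) :
    |Real.exp (-a) - Real.exp (-b)| ≤ |a - b| * Real.exp (-m) := by
  wlog hab : a ≤ b generalizing a b
  · rw [abs_sub_comm, abs_sub_comm a]
    exact this hb ha (le_of_not_ge hab)
  have h₁ : Real.exp (-b) = Real.exp (-a) * Real.exp (a - b) := by
    rw [← Real.exp_add]; ring_nf
  have h₂ := Real.add_one_le_exp (a - b)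
  have h₃ : Real.exp (-b) ≤ Real.exp (-a) := Real.exp_le_exp.2 (by linarith)
  rw [abs_of_nonneg (by linarith), abs_of_nonpos (by linarith)]
  calc Real.exp (-a) - Real.exp (-b) = (1 - Real.exp (a - b)) * Real.exp (-a) := by rw [h₁]; ring
    _ ≤ -(a - b) * Real.exp (-a) := by gcongr; linarith
    _ ≤ -(a - b) * Real.exp (-m) := by
        gcongr
        linarith

lemma sq_mul_exp_neg_le {c Q : ℝ} (hc : 0 < c) (hQ : 0 ≤ Q) :
    Q ^ 2 * Real.exp (-(c * Q)) ≤ 8 / c ^ 2 * Real.exp (-(c / 2 * Q)) := by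
  have h := Real.pow_div_factorial_le_exp (c / 2 * Q) (by positivity) 2
  have h₁ : Q ^ 2 ≤ 8 / c ^ 2 * Real.exp (c / 2 * Q) := by
    rw [div_mul_eq_mul_div, le_div_iff₀ (by positivity)]
    norm_num [Nat.factorial] at h
    nlinarith
  calc Q ^ 2 * Real.exp (-(c * Q))
      ≤ 8 / c ^ 2 * Real.exp (c / 2 * Q) * Real.exp (-(c * Q)) := by gcongr
    _ = _ := by rw [mul_assoc, ← Real.exp_add]; ring_nf

lemma integrable_exp_neg_mul_norm_rpow {E : Type*} [NormedAddCommGroup E] [NormedSpace ℝ E]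
    [Nontrivial E] [FiniteDimensional ℝ E] [MeasurableSpace E] [BorelSpace E] (μ : Measure E)
    [μ.IsAddHaarMeasure] {b r : ℝ} (hb : 0 < b) (hr : 0 < r) :
    Integrable (fun x : E => Real.exp (-(b * ‖x‖ ^ r))) μ := by
  rw [integrable_fun_norm_addHaar μ (f := fun x : ℝ => Real.exp (-(b * x ^ r)))]
  have hdim : (0 : ℝ) ≤ (Module.finrank ℝ E - 1 : ℕ) := Nat.cast_nonneg _
  simpa using integrableOn_rpow_mul_exp_neg_mul_rpow (neg_one_lt_zero.trans_le hdim) hr hb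

/-- Fix `d ≥ 1`, `s ∈ (0,1)`, `t₀ > 0`.  There are `ε₀ > 0` and `C > 0` depending only on
`d, s, t₀` such that for every bounded measurable `g : ℝ^d → ℂ`, every `ε ∈ (0, ε₀]` and
every `t ≥ t₀`:
`∫∫ |g(ξ)|² |e^{−J(ε,t,k,ξ)} − e^{−(|ξ|^{2s} t + |k|^{2s}/(2s))}|² dk dξ
   ≤ C ε^{2s} (sup_ξ |g(ξ)|)²`. -/
theorem stmt_7 (d : ℕ) (hd : 1 ≤ d) (s t₀ : ℝ) (hs : s ∈ Set.Ioo (0 : ℝ) 1) (ht₀ : 0 < t₀) :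
    ∃ ε₀ : ℝ, 0 < ε₀ ∧ ∃ C : ℝ, 0 < C ∧
      ∀ g : EuclideanSpace ℝ (Fin d) → ℂ, Measurable g →
        BddAbove (Set.range fun ξ => ‖g ξ‖) →
        ∀ ε ∈ Set.Ioc (0 : ℝ) ε₀, ∀ t : ℝ, t₀ ≤ t →
          (∫ ξ : EuclideanSpace ℝ (Fin d), ∫ k : EuclideanSpace ℝ (Fin d),
              ‖g ξ‖ ^ 2 *
                |Real.exp (-Jfun d s ε t k ξ) -
                    Real.exp (-(‖ξ‖ ^ (2 * s) * t + ‖k‖ ^ (2 * s) / (2 * s)))| ^ 2) ≤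
            C * ε ^ (2 * s) * (⨆ ξ : EuclideanSpace ℝ (Fin d), ‖g ξ‖) ^ 2 := by
  obtain ⟨hs₀, hs₁⟩ := hs
  have : NeZero d := ⟨by lia⟩
  set K : ℝ := 5 / s + 1 / (2 * s ^ 2 * t₀) with hK
  have hKpos : 0 < K := by positivity
  set c : ℝ := min t₀ (1 / (2 * s)) with hc
  have hcpos : 0 < c := lt_min ht₀ (by positivity)
  set F : EuclideanSpace ℝ (Fin d) → ℝ := fun x => Real.exp (-(c / 2 * ‖x‖ ^ (2 * s)))
  have hF : Integrable F :=
    integrable_exp_neg_mul_norm_rpow volume (by positivity) (by positivity)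
  have hpt : ∀ ε ∈ Set.Ioc (0 : ℝ) (min 1 ((c / (2 * K)) ^ s⁻¹)), ∀ t : ℝ, t₀ ≤ t →
      ∀ k ξ : EuclideanSpace ℝ (Fin d), |Real.exp (-Jfun d s ε t k ξ) -
        Real.exp (-(‖ξ‖ ^ (2 * s) * t + ‖k‖ ^ (2 * s) / (2 * s)))| ^ 2 ≤
        K ^ 2 * (8 / c ^ 2) * ε ^ (2 * s) * (F ξ * F k) := by
    intro ε hε t ht k ξ
    have hε₀ := hε.1
    have hε₁ : ε ≤ 1 := hε.2.trans (min_le_left _ _)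
    have hεs : ε ^ s ≤ c / (2 * K) := by
      calc ε ^ s ≤ ((c / (2 * K)) ^ s⁻¹) ^ s := by
            gcongr; exact hε.2.trans (min_le_right _ _)
        _ = _ := Real.rpow_inv_rpow (by positivity) hs₀.ne'
    have hJA := abs_Jfun_sub_le d hs₀ hs₁.le ht₀ hε₀ hε₁ ht k ξ
    rw [← hK] at hJA
    set Q := ‖k‖ ^ (2 * s) + ‖ξ‖ ^ (2 * s) with hQ
    have hQ₀ : 0 ≤ Q := by positivity
    have hA : c * Q ≤ ‖ξ‖ ^ (2 * s) * t + ‖k‖ ^ (2 * s) / (2 * s) := by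
      have h₁ : ‖ξ‖ ^ (2 * s) * c ≤ ‖ξ‖ ^ (2 * s) * t := by
        gcongr; exact (min_le_left _ _).trans ht
      have h₂ : ‖k‖ ^ (2 * s) * c ≤ ‖k‖ ^ (2 * s) * (1 / (2 * s)) := by
        gcongr; exact min_le_right _ _
      rw [mul_one_div] at h₂
      linarith
    set A := ‖ξ‖ ^ (2 * s) * t + ‖k‖ ^ (2 * s) / (2 * s)
    have hsmall : K * ε ^ s * Q ≤ c / 2 * Q := by
      gcongr
      calc K * ε ^ s ≤ K * (c / (2 * K)) := by gcongr
        _ = c / 2 := by field_simp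
    have hcQ : 0 ≤ c * Q := by positivity
    have hexp := abs_exp_neg_sub_exp_neg_le (m := c / 2 * Q) (a := Jfun d s ε t k ξ) (b := A)
      (by linarith [(abs_le.1 hJA).1]) (by linarith)
    calc _ ≤ (K * ε ^ s * Q * Real.exp (-(c / 2 * Q))) ^ 2 := by
          gcongr
          exact hexp.trans (by gcongr)
      _ = K ^ 2 * ε ^ (2 * s) * (Q ^ 2 * Real.exp (-(c * Q))) := by
          rw [Real.two_mul_rpow_eq_sq hε₀.le, mul_pow, ← Real.exp_nat_mul]
          push_cast
          ring_nf
      _ ≤ K ^ 2 * ε ^ (2 * s) * (8 / c ^ 2 * Real.exp (-(c / 2 * Q))) :=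
          mul_le_mul_of_nonneg_left (sq_mul_exp_neg_le hcpos hQ₀) (by positivity)
      _ = _ := by
          have : Real.exp (-(c / 2 * Q)) = F ξ * F k := by
            simp only [F]
            rw [← Real.exp_add, hQ]; ring_nf
          rw [this]; ring
  refine ⟨min 1 ((c / (2 * K)) ^ s⁻¹), by positivity,
    K ^ 2 * (8 / c ^ 2) * ((∫ x, F x) ^ 2 + 1), by positivity, ?_⟩
  intro g _ hg ε hε t ht
  set M := ⨆ ξ : EuclideanSpace ℝ (Fin d), ‖g ξ‖
  have hgM : ∀ ξ, ‖g ξ‖ ≤ M := fun ξ => le_ciSup hg ξ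
  have hε₀ := hε.1
  set D := M ^ 2 * (K ^ 2 * (8 / c ^ 2) * ε ^ (2 * s))
  have hinner : ∀ ξ : EuclideanSpace ℝ (Fin d), (∫ k : EuclideanSpace ℝ (Fin d), ‖g ξ‖ ^ 2 *
      |Real.exp (-Jfun d s ε t k ξ) -
        Real.exp (-(‖ξ‖ ^ (2 * s) * t + ‖k‖ ^ (2 * s) / (2 * s)))| ^ 2) ≤
      D * F ξ * ∫ k, F k := by
    intro ξ
    rw [← integral_const_mul]
    refine integral_mono_of_nonneg (ae_of_all _ fun k => by positivity) (hF.const_mul _)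
      (ae_of_all _ fun k => ?_)
    calc _ ≤ M ^ 2 * (K ^ 2 * (8 / c ^ 2) * ε ^ (2 * s) * (F ξ * F k)) :=
          mul_le_mul (pow_le_pow_left₀ (norm_nonneg _) (hgM ξ) 2) (hpt ε hε t ht k ξ)
            (by positivity) (by positivity)
      _ = _ := by simp only [D]; ring
  calc _ ≤ ∫ ξ, D * F ξ * ∫ k, F k :=
        integral_mono_of_nonneg
          (ae_of_all _ fun ξ => integral_nonneg fun k => by positivity)
          ((hF.const_mul _).mul_const _) (ae_of_all _ hinner)
    _ = D * (∫ x, F x) ^ 2 := by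
        rw [integral_mul_const, integral_const_mul]; ring
    _ ≤ D * ((∫ x, F x) ^ 2 + 1) := by
        gcongr
        linarith
    _ = _ := by simp only [D]; ring
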